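/- For every rational number r with 0 ≤ r ≤ 1, there exists a polynomial P ∈ ℤ[x] such that the natural density of S(P) within the primes equals r. -/

import Mathlib

open Polynomial Filter

namespace DS
open MeasureTheory Set Topology

noncomputable def K (v : ℝ) : ℝ := if v = 0 then 1 else 2 * (1 - Real.cos v) / v ^ 2

lemma K_nonneg (v : ℝ) : 0 ≤ K v := by
  unfold K; split_ifs
  · norm_num
  · have := Real.cos_le_one v
    positivity [sub_nonneg.2 this]

lemma K_le_one (v : ℝ) : K v ≤ 1 := by
  unfold K; split_ifs with h
  · norm_num
  · have := Real.one_sub_sq_div_two_le_cos (x := v)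
    rw [div_le_one (by positivity)]
    linarith

lemma K_le (v : ℝ) : K v ≤ 5 * (1 + v ^ 2)⁻¹ := by
  have h1 := K_le_one v
  have h2 : K v * v ^ 2 ≤ 4 := by
    unfold K; split_ifs with h
    · simp [h]
    · rw [div_mul_cancel₀ _ (by positivity)]
      linarith [Real.neg_one_le_cos v]
  rw [← div_eq_mul_inv, le_div_iff₀ (by positivity)]
  linarith

lemma K_meas : Measurable K := by
  unfold K
  exact Measurable.ite (measurableSet_singleton 0) measurable_const (by fun_prop)

lemma K_int : Integrable K := by
  refine (integrable_inv_one_add_sq.const_mul 5).mono' K_meas.aestronglyMeasurable ?_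
  refine Eventually.of_forall fun v => ?_
  rw [Real.norm_of_nonneg (K_nonneg v)]
  exact K_le v

lemma K_pos : 0 < ∫ v, K v := by
  rw [integral_pos_iff_support_of_nonneg K_nonneg K_int]
  refine lt_of_lt_of_le (b := volume (Ioo (0:ℝ) 1)) (by simp) (measure_mono ?_)
  intro v hv
  have h0 : v ≠ 0 := hv.1.ne'
  have : Real.cos v < 1 := by
    rw [← Real.cos_zero]
    exact Real.cos_lt_cos_of_nonneg_of_le_pi le_rfl (by linarith [hv.2, Real.pi_gt_three]) hv.1
  simp only [Function.mem_support, K, h0, if_false]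
  have : 0 < 1 - Real.cos v := by linarith
  positivity

lemma K_fourier (v : ℝ) :
    (K v : ℂ) = ∫ t in (-1:ℝ)..1, ((1 - |t| : ℝ) : ℂ) * Complex.exp (Complex.I * t * v) := by
  have hc : Continuous fun t : ℝ => ((1 - |t| : ℝ) : ℂ) * Complex.exp (Complex.I * t * v) := by
    fun_prop
  rw [← intervalIntegral.integral_add_adjacent_intervals (b := 0) (hc.intervalIntegrable _ _)
    (hc.intervalIntegrable _ _)]
  have e1 : ∫ t in (-1:ℝ)..0, ((1 - |t| : ℝ) : ℂ) * Complex.exp (Complex.I * t * v)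
      = ∫ t in (-1:ℝ)..0, (1 + (t:ℂ)) * Complex.exp (Complex.I * t * v) := by
    refine intervalIntegral.integral_congr fun t ht => ?_
    rw [uIcc_of_le (by norm_num)] at ht
    simp only [abs_of_nonpos ht.2]; push_cast; ring
  have e2 : ∫ t in (0:ℝ)..1, ((1 - |t| : ℝ) : ℂ) * Complex.exp (Complex.I * t * v)
      = ∫ t in (0:ℝ)..1, (1 - (t:ℂ)) * Complex.exp (Complex.I * t * v) := by
    refine intervalIntegral.integral_congr fun t ht => ?_
    rw [uIcc_of_le (by norm_num)] at ht
    simp only [abs_of_nonneg ht.1]; push_cast; ring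
  rw [e1, e2]
  by_cases hv : v = 0
  · subst hv
    simp only [K, if_true, Complex.ofReal_zero, mul_zero, Complex.exp_zero, mul_one]
    have a1 : ∫ t in (-1:ℝ)..0, (1 + (t:ℂ)) = ((∫ t in (-1:ℝ)..0, (1 + t) : ℝ) : ℂ) := by
      rw [← intervalIntegral.integral_ofReal]; push_cast; rfl
    have a2 : ∫ t in (0:ℝ)..1, (1 - (t:ℂ)) = ((∫ t in (0:ℝ)..1, (1 - t) : ℝ) : ℂ) := by
      rw [← intervalIntegral.integral_ofReal]; push_cast; rfl
    rw [a1, a2, intervalIntegral.integral_add (by simp) (by simp), intervalIntegral.integral_sub (by simp) (by simp)]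
    simp
    norm_num
  · set w : ℂ := Complex.I * v with hw
    have hw0 : w ≠ 0 := by simp [hw, hv]
    have E : ∀ t : ℝ, HasDerivAt (fun t : ℝ => Complex.exp (Complex.I * t * v))
        (Complex.exp (Complex.I * t * v) * w) t := by
      intro t
      have : HasDerivAt (fun t : ℝ => Complex.I * t * v) w t := by
        have := ((Complex.ofRealCLM.hasDerivAt (x := t)).const_mul Complex.I).mul_const (v:ℂ)
        simpa [hw] using this
      exact this.cexp
    have T : ∀ t : ℝ, HasDerivAt (fun t : ℝ => (t:ℂ)) 1 t := fun t => by
      simpa using (hasDerivAt_id t).ofReal_comp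
    have i1 := intervalIntegral.integral_eq_sub_of_hasDerivAt (a := -1) (b := 0)
      (f := fun t : ℝ => (1 + (t:ℂ)) * Complex.exp (Complex.I * t * v) / w
        - Complex.exp (Complex.I * t * v) / w ^ 2)
      (f' := fun t : ℝ => (1 + (t:ℂ)) * Complex.exp (Complex.I * t * v))
      (fun t _ => by
        convert! ((((T t).const_add 1).mul (E t)).div_const w).sub ((E t).div_const (w^2)) using 1
        field_simp
        ring) (Continuous.intervalIntegrable (by fun_prop) _ _)
    have i2 := intervalIntegral.integral_eq_sub_of_hasDerivAt (a := 0) (b := 1)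
      (f := fun t : ℝ => (1 - (t:ℂ)) * Complex.exp (Complex.I * t * v) / w
        + Complex.exp (Complex.I * t * v) / w ^ 2)
      (f' := fun t : ℝ => (1 - (t:ℂ)) * Complex.exp (Complex.I * t * v))
      (fun t _ => by
        convert! ((((T t).const_sub 1).mul (E t)).div_const w).add ((E t).div_const (w^2)) using 1
        field_simp
        ring) (Continuous.intervalIntegrable (by fun_prop) _ _)
    rw [i1, i2]
    simp only [K, hv, if_false]
    push_cast
    rw [Complex.cos]
    have hw2 : w ^ 2 = - (v:ℂ)^2 := by rw [hw, mul_pow, Complex.I_sq]; ring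
    have hv' : (v:ℂ) ≠ 0 := by exact_mod_cast hv
    rw [hw2]
    simp only [mul_neg, mul_one, neg_mul, mul_zero, zero_mul, Complex.exp_zero, mul_comm (v:ℂ) Complex.I]
    field_simp
    ring

section taub
variable {D : ℝ → ℝ} {M : ℝ} {H : ℂ → ℂ}

lemma step2 (hDm : Measurable D) (hDM : ∀ u, |D u| ≤ M)
    (hlap : ∀ s : ℂ, 0 < s.re → ∫ u in Ioi (0:ℝ), (D u : ℂ) * Complex.exp (-s * u) = H s)
    (l y ε : ℝ) (hε : 0 < ε) :
    ∫ u in Ioi (0:ℝ), (D u : ℂ) * Complex.exp (-(ε:ℂ) * u) * (K (l * (y - u)) : ℂ)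
      = ∫ t in (-1:ℝ)..1, ((1 - |t| : ℝ) : ℂ) * Complex.exp (Complex.I * t * (l * y)) *
          H (ε + Complex.I * t * l) := by
  have hM : 0 ≤ M := (abs_nonneg _).trans (hDM 0)
  simp_rw [K_fourier, intervalIntegral.integral_of_le (show (-1:ℝ) ≤ 1 by norm_num),
    ← integral_const_mul]
  rw [integral_integral_swap]
  · refine integral_congr_ae (Eventually.of_forall fun t => ?_)
    simp only
    rw [← hlap _ (by simp [hε]), ← integral_const_mul]
    refine integral_congr_ae (Eventually.of_forall fun u => ?_)
    simp only
    have : Complex.exp (-(ε:ℂ) * u) * Complex.exp (Complex.I * t * ((l * (y - u) : ℝ) : ℂ)) =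
        Complex.exp (Complex.I * t * (l * y)) * Complex.exp (-(ε + Complex.I * t * l) * u) := by
      rw [← Complex.exp_add, ← Complex.exp_add]
      congr 1
      push_cast; ring
    linear_combination ((D u : ℂ) * ((1 - |t| : ℝ) : ℂ)) * this
  · have g1 : Integrable (fun u : ℝ => M * Real.exp (-ε * u)) (volume.restrict (Ioi 0)) :=
      (integrableOn_exp_mul_Ioi (by linarith) 0).const_mul M
    have g2 : Integrable (fun _ : ℝ => (1:ℝ)) (volume.restrict (Ioc (-1) 1)) :=
      integrable_const _
    refine (g1.mul_prod g2).mono' ?_ ?_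
    · apply Measurable.aestronglyMeasurable
      unfold Function.uncurry
      fun_prop
    · have : ∀ᵐ z ∂((volume.restrict (Ioi (0:ℝ))).prod (volume.restrict (Ioc (-1:ℝ) 1))),
          z ∈ Ioi (0:ℝ) ×ˢ Ioc (-1:ℝ) 1 := by
        rw [Measure.prod_restrict]
        exact ae_restrict_mem (measurableSet_Ioi.prod measurableSet_Ioc)
      filter_upwards [this] with z hz
      have h2 : abs (1 - |z.2|) ≤ 1 := by
        have : |z.2| ≤ 1 := abs_le.2 ⟨hz.2.1.le, hz.2.2⟩
        rw [abs_le]; constructor <;> linarith [abs_nonneg z.2]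
      simp only [Function.uncurry, norm_mul, Complex.norm_real, Complex.norm_exp, Real.norm_eq_abs]
      have e1 : (-(ε:ℂ) * z.1).re = -ε * z.1 := by simp
      have e2 : (Complex.I * z.2 * ((l * (y - z.1) : ℝ) : ℂ)).re = 0 := by
        simp only [Complex.mul_re, Complex.mul_im, Complex.ofReal_re, Complex.ofReal_im,
          Complex.I_re, Complex.I_im]; ring
      rw [e1, e2, Real.exp_zero, mul_one]
      gcongr
      exact hDM _

lemma step3 (hDm : Measurable D) (hDM : ∀ u, |D u| ≤ M)
    (hH : ContinuousOn H {s | 0 ≤ s.re})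
    (hlap : ∀ s : ℂ, 0 < s.re → ∫ u in Ioi (0:ℝ), (D u : ℂ) * Complex.exp (-s * u) = H s)
    (l y : ℝ) (hl : 0 < l) :
    ∫ u in Ioi (0:ℝ), (D u : ℂ) * (K (l * (y - u)) : ℂ)
      = ∫ t in (-1:ℝ)..1, ((1 - |t| : ℝ) : ℂ) * Complex.exp (Complex.I * t * (l * y)) *
          H (Complex.I * t * l) := by
  have hM : 0 ≤ M := (abs_nonneg _).trans (hDM 0)
  have hKi : Integrable (fun u => K (l * (y - u))) := by
    have := (K_int.comp_mul_left' hl.ne').comp_sub_left y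
    exact this
  have hKm := K_meas
  have L : Tendsto (fun ε : ℝ => ∫ u in Ioi (0:ℝ), (D u : ℂ) * Complex.exp (-(ε:ℂ) * u) *
      (K (l * (y - u)) : ℂ)) (𝓝[>] 0)
      (𝓝 (∫ u in Ioi (0:ℝ), (D u : ℂ) * (K (l * (y - u)) : ℂ))) := by
    refine tendsto_integral_filter_of_dominated_convergence (fun u => M * K (l * (y - u))) ?_ ?_ ?_ ?_
    · refine Eventually.of_forall fun ε => Measurable.aestronglyMeasurable ?_
      fun_prop
    · filter_upwards [self_mem_nhdsWithin] with ε hε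
      filter_upwards [ae_restrict_mem measurableSet_Ioi] with u hu
      have hε' : 0 < ε := hε
      have hu' : 0 < u := hu
      simp only [norm_mul, Complex.norm_real, Complex.norm_exp, Real.norm_eq_abs,
        abs_of_nonneg (K_nonneg _)]
      have e1 : (-(ε:ℂ) * u).re = -(ε * u) := by simp
      rw [e1]
      have : Real.exp (-(ε * u)) ≤ 1 := Real.exp_le_one_iff.2 (by simp; positivity)
      have h3 := K_nonneg (l * (y - u))
      calc |D u| * Real.exp (-(ε * u)) * K (l * (y - u)) ≤ M * 1 * K (l * (y - u)) := by
            gcongr; exact hDM u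
        _ = _ := by ring
    · exact (hKi.const_mul M).integrableOn
    · refine Eventually.of_forall fun u => ?_
      have : Continuous fun ε : ℝ => (D u : ℂ) * Complex.exp (-(ε:ℂ) * u) *
        (K (l * (y - u)) : ℂ) := by fun_prop
      have := (this.tendsto 0).mono_left (nhdsWithin_le_nhds (s := Ioi 0))
      simpa using this
  have hcomp : IsCompact ((fun z : ℝ × ℝ => (z.1 : ℂ) + Complex.I * z.2 * l) ''
      (Icc 0 1 ×ˢ Icc (-1) 1)) :=
    (isCompact_Icc.prod isCompact_Icc).image (by fun_prop)
  have hsub : ((fun z : ℝ × ℝ => (z.1 : ℂ) + Complex.I * z.2 * l) ''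
      (Icc 0 1 ×ˢ Icc (-1) 1)) ⊆ {s | 0 ≤ s.re} := by
    rintro _ ⟨z, hz, rfl⟩
    simpa using hz.1.1
  obtain ⟨C, hC⟩ := hcomp.exists_bound_of_continuousOn (hH.mono hsub)
  have R : Tendsto (fun ε : ℝ => ∫ t in (-1:ℝ)..1, ((1 - |t| : ℝ) : ℂ) *
        Complex.exp (Complex.I * t * (l * y)) * H (ε + Complex.I * t * l)) (𝓝[>] 0)
      (𝓝 (∫ t in (-1:ℝ)..1, ((1 - |t| : ℝ) : ℂ) * Complex.exp (Complex.I * t * (l * y)) *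
          H (Complex.I * t * l))) := by
    refine intervalIntegral.tendsto_integral_filter_of_dominated_convergence (fun t => C) ?_ ?_ ?_ ?_
    · filter_upwards [self_mem_nhdsWithin] with ε hε
      have hε' : 0 < ε := hε
      refine Continuous.aestronglyMeasurable ?_
      refine Continuous.mul (by fun_prop) ?_
      refine hH.comp_continuous (by fun_prop) fun t => ?_
      simp [hε'.le]
    · filter_upwards [Ioc_mem_nhdsGT (show (0:ℝ) < 1 by norm_num)] with ε hε
      refine Eventually.of_forall fun t ht => ?_
      rw [uIoc_of_le (by norm_num)] at ht
      have h1 := hC _ ⟨(ε, t), ⟨⟨hε.1.le, hε.2⟩, ⟨ht.1.le, ht.2⟩⟩, rfl⟩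
      simp only at h1
      have h2 : abs (1 - |t|) ≤ 1 := by
        have : |t| ≤ 1 := abs_le.2 ⟨ht.1.le, ht.2⟩
        rw [abs_le]; constructor <;> linarith [abs_nonneg t]
      simp only [norm_mul, Complex.norm_real, Complex.norm_exp, Real.norm_eq_abs]
      have e2 : (Complex.I * t * (l * y)).re = 0 := by
        simp 
      rw [e2, Real.exp_zero, mul_one]
      calc _ ≤ 1 * C := by gcongr
        _ = C := one_mul C
    · simp
    · refine Eventually.of_forall fun t ht => ?_
      refine Tendsto.const_mul _ ?_
      have h0 : ContinuousWithinAt H {s | 0 ≤ s.re} (Complex.I * t * l) := hH _ (by simp)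
      refine h0.tendsto.comp (tendsto_nhdsWithin_iff.2 ⟨?_, ?_⟩)
      · have : Continuous fun ε : ℝ => (ε:ℂ) + Complex.I * t * l := by fun_prop
        have := (this.tendsto 0).mono_left (nhdsWithin_le_nhds (s := Ioi 0))
        simpa using this
      · filter_upwards [self_mem_nhdsWithin] with ε hε
        have hε' : 0 < ε := hε
        simp [hε'.le]
  refine tendsto_nhds_unique L (R.congr' ?_)
  filter_upwards [self_mem_nhdsWithin] with ε hε
  exact (step2 hDm hDM hlap l y ε hε).symm

lemma step4 (l : ℝ) (hl : 0 < l) (g : ℝ → ℂ) :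
    Tendsto (fun y : ℝ => ∫ t in (-1:ℝ)..1, ((1 - |t| : ℝ) : ℂ) *
      Complex.exp (Complex.I * t * (l * y)) * g t) atTop (𝓝 0) := by
  have h := Real.tendsto_integral_exp_smul_cocompact
    ((Ioc (-1:ℝ) 1).indicator fun t => ((1 - |t| : ℝ) : ℂ) * g t)
  have hy : Tendsto (fun y : ℝ => -(l * y) / (2 * Real.pi)) atTop (cocompact ℝ) := by
    refine Tendsto.mono_right ?_ atBot_le_cocompact
    refine Tendsto.atBot_div_const (by positivity) ?_
    exact tendsto_neg_atTop_atBot.comp (tendsto_id.const_mul_atTop hl)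
  refine (h.comp hy).congr fun y => ?_
  simp only [Function.comp]
  rw [intervalIntegral.integral_of_le (by norm_num), ← integral_indicator measurableSet_Ioc]
  refine integral_congr_ae (Eventually.of_forall fun t => ?_)
  simp only [indicator]
  split_ifs
  · rw [Circle.smul_def, Real.fourierChar_apply, smul_eq_mul]
    have : ((2 * Real.pi * -(t * (-(l * y) / (2 * Real.pi))) : ℝ) : ℂ) * Complex.I
        = Complex.I * t * (l * y) := by
      have : (Real.pi : ℂ) ≠ 0 := by exact_mod_cast Real.pi_ne_zero
      push_cast
      field_simp
    rw [this]; ring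
  · simp
end taub

section taub2
variable {B : ℝ → ℝ} {M c : ℝ} {H : ℂ → ℂ}

lemma K_int_shift (l y : ℝ) (hl : 0 < l) : Integrable (fun u => K (l * (y - u))) := by
  have := (K_int.comp_mul_left' hl.ne').comp_sub_left y
  exact this

lemma K_integral_shift (l y : ℝ) (hl : 0 < l) :
    ∫ u, K (l * (y - u)) = (∫ v, K v) / l := by
  rw [integral_sub_left_eq_self (fun u => K (l * u)) volume y, Measure.integral_comp_mul_left]
  rw [abs_of_pos (by positivity), smul_eq_mul]; field_simp

lemma K_local (l y δ : ℝ) (hl : 0 < l) (hδ : 0 < δ) :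
    ∫ u in Ioc (y - δ) (y + δ), K (l * (y - u)) = (∫ v in (-(l * δ))..(l * δ), K v) / l := by
  rw [← intervalIntegral.integral_of_le (by linarith),
    intervalIntegral.integral_comp_sub_left (fun u => K (l * u)),
    intervalIntegral.integral_comp_mul_left _ hl.ne', smul_eq_mul]
  rw [div_eq_inv_mul]
  congr 2 <;> ring

lemma step5a (l : ℝ) (hl : 0 < l) :
    Tendsto (fun y : ℝ => ∫ u in Ioi (0:ℝ), K (l * (y - u))) atTop (𝓝 ((∫ v, K v) / l)) := by
  have hKm := K_meas
  have h1 : ∀ y : ℝ, ∫ u in Ioi (0:ℝ), K (l * (y - u)) =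
      ∫ w, (Iio y).indicator (fun w => K (l * w)) w := by
    intro y
    rw [← integral_indicator measurableSet_Ioi, ← integral_sub_left_eq_self _ volume y]
    refine integral_congr_ae (Eventually.of_forall fun u => ?_)
    simp [indicator]
  simp_rw [h1]
  have h2 : (∫ v, K v) / l = ∫ w, K (l * w) := by
    rw [← K_integral_shift l 0 hl, integral_sub_left_eq_self (fun u => K (l * u)) volume 0]
  rw [h2]
  refine tendsto_integral_filter_of_dominated_convergence (fun w => K (l * w)) ?_ ?_ ?_ ?_
  · refine Eventually.of_forall fun y => Measurable.aestronglyMeasurable ?_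
    exact Measurable.indicator (by fun_prop) measurableSet_Iio
  · refine Eventually.of_forall fun y => Eventually.of_forall fun w => ?_
    refine (norm_indicator_le_norm_self _ _).trans ?_
    rw [Real.norm_of_nonneg (K_nonneg _)]
  · exact K_int.comp_mul_left' hl.ne'
  · refine Eventually.of_forall fun w => ?_
    refine tendsto_const_nhds.congr' ?_
    filter_upwards [eventually_gt_atTop w] with y hy
    rw [indicator_of_mem]; exact hy

lemma step5 (hBm : Measurable B) (hB0 : ∀ u, 0 ≤ B u) (hBM : ∀ u, B u ≤ M)
    (hH : ContinuousOn H {s | 0 ≤ s.re})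
    (hlap : ∀ s : ℂ, 0 < s.re →
      ∫ u in Ioi (0:ℝ), ((B u - c : ℝ) : ℂ) * Complex.exp (-s * u) = H s)
    (l : ℝ) (hl : 0 < l) :
    Tendsto (fun y : ℝ => ∫ u in Ioi (0:ℝ), B u * K (l * (y - u))) atTop
      (𝓝 (c * ((∫ v, K v) / l))) := by
  have hD : ∀ u, |B u - c| ≤ M + |c| := fun u => by
    refine (abs_sub _ _).trans ?_
    rw [abs_of_nonneg (hB0 u)]; linarith [hBM u]
  have h1 := step4 l hl (fun t => H (Complex.I * t * l))
  have h2 : Tendsto (fun y : ℝ => ∫ u in Ioi (0:ℝ), (B u - c) * K (l * (y - u))) atTop (𝓝 0) := by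
    have h3 : ∀ y : ℝ, ((∫ u in Ioi (0:ℝ), (B u - c) * K (l * (y - u)) : ℝ) : ℂ) =
      ∫ t in (-1:ℝ)..1, ((1 - |t| : ℝ) : ℂ) * Complex.exp (Complex.I * t * (l * y)) *
          H (Complex.I * t * l) := by
      intro y
      rw [← step3 (D := fun u => B u - c) (by fun_prop) hD hH hlap l y hl, ← integral_complex_ofReal]
      push_cast
      rfl
    simp_rw [← h3] at h1
    simpa [Function.comp_def] using (Complex.continuous_re.tendsto _).comp h1
  have h4 := h2.add ((step5a l hl).const_mul c)
  rw [zero_add] at h4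
  refine h4.congr fun y => ?_
  rw [← integral_const_mul, ← integral_add]
  · refine integral_congr_ae (Eventually.of_forall fun u => ?_)
    simp only; ring
  · refine (Integrable.bdd_mul (c := M + |c|) (K_int_shift l y hl) ?_ ?_).integrableOn
    · exact (hBm.sub_const c).aestronglyMeasurable
    · exact Eventually.of_forall hD
  · exact ((K_int_shift l y hl).const_mul c).integrableOn

lemma BK_int (hBm : Measurable B) (hB0 : ∀ u, 0 ≤ B u) (hBM : ∀ u, B u ≤ M) (l y : ℝ)
    (hl : 0 < l) : Integrable (fun u => B u * K (l * (y - u))) := by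
  refine Integrable.bdd_mul (c := M) (K_int_shift l y hl) hBm.aestronglyMeasurable ?_
  exact Eventually.of_forall fun u => by rw [Real.norm_of_nonneg (hB0 u)]; exact hBM u

lemma upper (hBm : Measurable B) (hB0 : ∀ u, 0 ≤ B u) (hBM : ∀ u, B u ≤ M)
    (hmono : ∀ u v, u ≤ v → B u * Real.exp u ≤ B v * Real.exp v)
    (l δ y : ℝ) (hl : 0 < l) (hδ : 0 < δ) (hy : 0 ≤ y) :
    B y * Real.exp (-(2 * δ)) * ((∫ v in (-(l * δ))..(l * δ), K v) / l) ≤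
      ∫ u in Ioi (0:ℝ), B u * K (l * (y + δ - u)) := by
  rw [← K_local l (y + δ) δ hl hδ, ← integral_const_mul]
  have hi := BK_int hBm hB0 hBM l (y + δ) hl
  calc _ ≤ ∫ u in Ioc (y + δ - δ) (y + δ + δ), B u * K (l * (y + δ - u)) := by
        refine setIntegral_mono_on ((K_int_shift l _ hl).const_mul _).integrableOn hi.integrableOn
          measurableSet_Ioc fun u hu => ?_
        refine mul_le_mul_of_nonneg_right ?_ (K_nonneg _)
        have h1 := hmono y u (by linarith [hu.1])
        have h2 : B y * Real.exp (y - u) ≤ B u := by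
          rw [Real.exp_sub, ← mul_div_assoc, div_le_iff₀ (Real.exp_pos _)]; exact h1
        refine le_trans ?_ h2
        refine mul_le_mul_of_nonneg_left (Real.exp_le_exp.2 (by linarith [hu.2])) (hB0 _)
    _ ≤ _ := by
        refine setIntegral_mono_set hi.integrableOn ?_ ?_
        · exact Eventually.of_forall fun u => mul_nonneg (hB0 _) (K_nonneg _)
        · refine LE.le.eventuallyLE fun u hu => ?_
          have := hu.1
          simp only [mem_Ioi]; linarith

lemma lower (hBm : Measurable B) (hB0 : ∀ u, 0 ≤ B u) (hBM : ∀ u, B u ≤ M)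
    (hmono : ∀ u v, u ≤ v → B u * Real.exp u ≤ B v * Real.exp v)
    (l δ y : ℝ) (hl : 0 < l) (hδ : 0 < δ) :
    ∫ u in Ioi (0:ℝ), B u * K (l * (y - δ - u)) ≤ B y * Real.exp (2 * δ) * ((∫ v, K v) / l) +
      M * ((∫ v, K v) / l - (∫ v in (-(l * δ))..(l * δ), K v) / l) := by
  rw [← K_local l (y - δ) δ hl hδ, ← K_integral_shift l (y - δ) hl, ← integral_const_mul,
    ← integral_indicator measurableSet_Ioc, ← integral_sub, ← integral_const_mul, ← integral_add]
  rotate_left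
  · exact (K_int_shift l _ hl).const_mul _
  · exact ((K_int_shift l _ hl).sub ((K_int_shift l _ hl).indicator measurableSet_Ioc)).const_mul M
  · exact K_int_shift l _ hl
  · exact (K_int_shift l _ hl).indicator measurableSet_Ioc
  have hi := BK_int hBm hB0 hBM l (y - δ) hl
  refine (setIntegral_le_integral hi ?_).trans ?_
  · exact Eventually.of_forall fun u => mul_nonneg (hB0 _) (K_nonneg _)
  refine integral_mono hi ?_ fun u => ?_
  · exact ((K_int_shift l _ hl).const_mul _).add
      (((K_int_shift l _ hl).sub ((K_int_shift l _ hl).indicator measurableSet_Ioc)).const_mul M)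
  · have hk := K_nonneg (l * (y - δ - u))
    simp only [indicator]
    split_ifs with hu
    · rw [sub_self, mul_zero, add_zero]
      refine mul_le_mul_of_nonneg_right ?_ hk
      have h1 := hmono u y (by linarith [hu.2])
      have h2 : B u ≤ B y * Real.exp (y - u) := by
        rw [Real.exp_sub, ← mul_div_assoc, le_div_iff₀ (Real.exp_pos _)]; exact h1
      refine h2.trans ?_
      refine mul_le_mul_of_nonneg_left (Real.exp_le_exp.2 (by linarith [hu.1])) (hB0 _)
    · rw [sub_zero]
      have := mul_le_mul_of_nonneg_right (hBM u) hk
      have h3 : 0 ≤ B y * Real.exp (2 * δ) * K (l * (y - δ - u)) :=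
        mul_nonneg (mul_nonneg (hB0 _) (Real.exp_pos _).le) hk
      linarith

theorem tauber (hBm : Measurable B) (hB0 : ∀ u, 0 ≤ B u) (hBM : ∀ u, B u ≤ M)
    (hmono : ∀ u v, u ≤ v → B u * Real.exp u ≤ B v * Real.exp v)
    (hH : ContinuousOn H {s | 0 ≤ s.re})
    (hlap : ∀ s : ℂ, 0 < s.re →
      ∫ u in Ioi (0:ℝ), ((B u - c : ℝ) : ℂ) * Complex.exp (-s * u) = H s) :
    Tendsto B atTop (𝓝 c) := by
  set I := ∫ v, K v with hI
  have hIpos : 0 < I := K_pos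
  let d : ℕ → ℝ := fun n => 1 / ((n:ℝ) + 1)
  let R : ℕ → ℝ := fun n => ∫ v in (-((n:ℝ) + 1))..((n:ℝ) + 1), K v
  have hd : Tendsto d atTop (𝓝 0) := tendsto_one_div_add_atTop_nhds_zero_nat
  have hd0 : ∀ n, 0 < d n := fun n => by positivity
  have ht : Tendsto (fun n : ℕ => (n:ℝ) + 1) atTop atTop :=
    tendsto_atTop_add_const_right _ _ tendsto_natCast_atTop_atTop
  have hR : Tendsto R atTop (𝓝 I) :=
    intervalIntegral_tendsto_integral K_int (tendsto_neg_atTop_atBot.comp ht) ht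
  have hexp : Tendsto (fun n => Real.exp (2 * d n)) atTop (𝓝 1) := by
    have : Tendsto (fun n => Real.exp (2 * d n)) atTop (𝓝 (Real.exp (2 * 0))) :=
      (Real.continuous_exp.tendsto _).comp (hd.const_mul 2)
    simpa using this
  have hU : Tendsto (fun n => (c * I + d n) * Real.exp (2 * d n) / R n) atTop (𝓝 c) := by
    have := (((hd.const_add (c * I)).mul hexp).div hR hIpos.ne')
    rwa [add_zero, mul_one, mul_div_assoc, div_self hIpos.ne', mul_one] at this
  have hL : Tendsto (fun n => (c * I - d n - M * (I - R n)) / (Real.exp (2 * d n) * I)) atTop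
      (𝓝 c) := by
    have := (((hd.const_sub (c * I)).sub ((hR.const_sub I).const_mul M)).div
      (hexp.mul_const I) (by simpa using hIpos.ne'))
    rwa [sub_self, mul_zero, sub_zero, sub_zero, one_mul, mul_div_assoc, div_self hIpos.ne',
      mul_one] at this
  rw [tendsto_order]
  constructor
  · intro a ha
    obtain ⟨n, hn⟩ := (hL.eventually (lt_mem_nhds ha)).exists
    have hl : (0:ℝ) < ((n:ℝ) + 1) ^ 2 := by positivity
    have h5 := (step5 hBm hB0 hBM hH hlap _ hl)
    have h6 : Tendsto (fun y : ℝ => y - d n) atTop atTop := tendsto_atTop_add_const_right _ _ tendsto_id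
    have h7 : c * (I / ((n:ℝ) + 1) ^ 2) - d n / ((n:ℝ) + 1) ^ 2 < c * (I / ((n:ℝ) + 1) ^ 2) := by
      have := hd0 n
      have : 0 < d n / ((n:ℝ) + 1) ^ 2 := by positivity
      linarith
    filter_upwards [(h5.comp h6).eventually (lt_mem_nhds h7)] with y hy
    have h8 := lower hBm hB0 hBM hmono _ _ y hl (hd0 n)
    have hld : ((n:ℝ) + 1) ^ 2 * d n = (n:ℝ) + 1 := by
      simp only [d]; field_simp
    rw [hld] at h8
    have h9 := hy.trans_le h8
    refine hn.trans ?_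
    rw [div_lt_iff₀ (by positivity)]
    change _ < B y * Real.exp (2 * d n) * (I / _) + M * (I / _ - R n / _) at h9
    have h10 := mul_lt_mul_of_pos_right h9 hl
    field_simp at h10
    rw [mul_comm (d n) 2] at h10
    linarith
  · intro a ha
    obtain ⟨n, hn, hRn⟩ := ((hU.eventually (gt_mem_nhds ha)).and
      (hR.eventually (lt_mem_nhds hIpos))).exists
    have hl : (0:ℝ) < ((n:ℝ) + 1) ^ 2 := by positivity
    have h5 := (step5 hBm hB0 hBM hH hlap _ hl)
    have h6 : Tendsto (fun y : ℝ => y + d n) atTop atTop := tendsto_atTop_add_const_right _ _ tendsto_id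
    have h7 : c * (I / ((n:ℝ) + 1) ^ 2) < c * (I / ((n:ℝ) + 1) ^ 2) + d n / ((n:ℝ) + 1) ^ 2 := by
      have := hd0 n
      have : 0 < d n / ((n:ℝ) + 1) ^ 2 := by positivity
      linarith
    filter_upwards [(h5.comp h6).eventually (gt_mem_nhds h7), eventually_ge_atTop 0] with y hy hy0
    have h8 := upper hBm hB0 hBM hmono _ _ y hl (hd0 n) hy0
    have hld : ((n:ℝ) + 1) ^ 2 * d n = (n:ℝ) + 1 := by
      simp only [d]; field_simp
    rw [hld] at h8
    have h9 := h8.trans_lt hy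
    refine lt_trans ?_ hn
    rw [lt_div_iff₀ hRn]
    change B y * Real.exp (-(2 * d n)) * (R n / _) < _ at h9
    rw [Real.exp_neg] at h9
    have h10 := mul_lt_mul_of_pos_right h9 hl
    have hE := Real.exp_pos (2 * d n)
    have h11 : B y * R n / Real.exp (2 * d n) < c * I + d n := by
      have e : B y * (Real.exp (2 * d n))⁻¹ * (R n / ((n:ℝ) + 1) ^ 2) * ((n:ℝ) + 1) ^ 2 =
        B y * R n / Real.exp (2 * d n) := by field_simp
      have e2 : (c * (I / ((n:ℝ) + 1) ^ 2) + d n / ((n:ℝ) + 1) ^ 2) * ((n:ℝ) + 1) ^ 2 = c * I + d n := by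
        field_simp
      rw [e, e2] at h10; exact h10
    rwa [div_lt_iff₀ hE] at h11
end taub2

set_option linter.unusedSectionVars false


section ap
open ArithmeticFunction ArithmeticFunction.vonMangoldt

variable {q : ℕ} [NeZero q] {a : ZMod q}

/-- partial sums of the von Mangoldt function in a residue class -/
noncomputable def A (a : ZMod q) (x : ℝ) : ℝ := ∑ n ∈ Finset.Icc 1 ⌊x⌋₊, residueClass a n

lemma A_nonneg (x : ℝ) : 0 ≤ A a x := Finset.sum_nonneg fun n _ => residueClass_nonneg a n

lemma A_le_psi (x : ℝ) : A a x ≤ Chebyshev.psi x :=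
  Finset.sum_le_sum fun n _ => residueClass_le a n

lemma A_mono : Monotone (A a) := fun x y h => by
  refine Finset.sum_le_sum_of_subset_of_nonneg ?_ fun n _ _ => residueClass_nonneg a n
  exact Finset.Icc_subset_Icc le_rfl (Nat.floor_mono h)

lemma A_laplace (ha : IsUnit a) (s : ℂ) (hs : 0 < s.re) :
    ∫ u in Ioi (0:ℝ), ((A a (Real.exp u) * Real.exp (-u) : ℝ) : ℂ) * Complex.exp (-s * u) =
      (LFunctionResidueClassAux a (1 + s) + (q.totient : ℂ)⁻¹ / s) / (1 + s) := by
  have h1 : 1 < (1 + s).re := by simpa using hs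
  have h2 := eqOn_LFunctionResidueClassAux ha h1
  simp only [add_sub_cancel_left] at h2
  have hO : (fun n : ℕ => ∑ k ∈ Finset.Icc 1 n, residueClass a k) =O[atTop]
      fun n => (n:ℝ) ^ (1:ℝ) := by
    refine Asymptotics.IsBigO.of_bound (Real.log 4 + 4) (Eventually.of_forall fun n => ?_)
    have e : ∑ k ∈ Finset.Icc 1 n, residueClass a k = A a n := by simp [A]
    rw [e, Real.norm_of_nonneg (A_nonneg _), Real.rpow_one, Real.norm_of_nonneg (by positivity)]
    exact (A_le_psi _).trans (Chebyshev.psi_le_const_mul_self (by positivity))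
  have h3 := LSeries_eq_mul_integral_of_nonneg (residueClass a) zero_le_one h1 hO
    (residueClass_nonneg a)
  have h4 := integral_comp_exp_Ioi
    (fun t : ℝ => (∑ k ∈ Finset.Icc 1 ⌊t⌋₊, (residueClass a k : ℂ)) * (t:ℂ) ^ (-(1 + s + 1))) 0
  rw [Real.exp_zero] at h4
  rw [← h4] at h3
  have hne : (1 + s) ≠ 0 := fun h => by rw [h] at h1; simp at h1; linarith
  rw [eq_div_iff hne, h2, h3, sub_add_cancel, mul_comm]
  congr 1
  refine integral_congr_ae (Eventually.of_forall fun u => ?_)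
  simp only [Complex.real_smul, A]
  rw [Complex.cpow_def_of_ne_zero (by exact_mod_cast (Real.exp_pos u).ne'),
    ← Complex.ofReal_log (Real.exp_pos u).le, Real.log_exp]
  push_cast
  have : Complex.exp (-(u:ℂ)) * Complex.exp (-s * u) =
    Complex.exp u * Complex.exp (u * (-(1 + s + 1))) := by
    rw [← Complex.exp_add, ← Complex.exp_add]; congr 1; ring
  linear_combination (∑ k ∈ Finset.Icc 1 ⌊Real.exp u⌋₊, (residueClass a k : ℂ)) * this

theorem A_tendsto (ha : IsUnit a) :
    Tendsto (fun x : ℝ => A a x / x) atTop (𝓝 ((q.totient : ℝ)⁻¹)) := by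
  have hBm : Measurable fun u : ℝ => A a (Real.exp u) * Real.exp (-u) := by
    have := (A_mono (a := a)).measurable
    fun_prop
  have hB0 : ∀ u : ℝ, 0 ≤ A a (Real.exp u) * Real.exp (-u) := fun u =>
    mul_nonneg (A_nonneg _) (Real.exp_pos _).le
  have hBM : ∀ u : ℝ, A a (Real.exp u) * Real.exp (-u) ≤ Real.log 4 + 4 := fun u => by
    rw [Real.exp_neg, ← div_eq_mul_inv, div_le_iff₀ (Real.exp_pos _)]
    exact (A_le_psi _).trans (Chebyshev.psi_le_const_mul_self (Real.exp_pos _).le)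
  have key : Tendsto (fun u : ℝ => A a (Real.exp u) * Real.exp (-u)) atTop
      (𝓝 ((q.totient : ℝ)⁻¹)) := by
    refine tauber (M := Real.log 4 + 4) 
      (H := fun s => (LFunctionResidueClassAux a (1 + s) - (q.totient : ℂ)⁻¹) / (1 + s))
      hBm hB0 hBM ?_ ?_ ?_
    · intro u v huv
      rw [mul_assoc, mul_assoc, ← Real.exp_add, ← Real.exp_add]
      simpa using A_mono (Real.exp_le_exp.2 huv)
    · refine ContinuousOn.div (ContinuousOn.sub ?_ continuousOn_const) (by fun_prop) ?_
      · refine (continuousOn_LFunctionResidueClassAux a).comp (by fun_prop) fun s hs => ?_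
        simpa using hs
      · intro s hs h
        have hs' : 0 ≤ s.re := hs
        have := congrArg Complex.re h
        simp at this; linarith
    · intro s hs
      have hs0 : s ≠ 0 := fun h => by simp [h] at hs
      have hne : (1 + s) ≠ 0 := fun h => by
        have := congrArg Complex.re h
        simp at this; linarith
      have hexp : Integrable (fun u : ℝ => Complex.exp (-s * u)) (volume.restrict (Ioi 0)) :=
        integrableOn_exp_mul_complex_Ioi (by simpa using hs) 0
      have hE : ∫ u in Ioi (0:ℝ), Complex.exp (-s * u) = 1 / s := by
        rw [integral_exp_mul_complex_Ioi (by simpa using hs) 0]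
        simp
      have e : ∀ u : ℝ, ((A a (Real.exp u) * Real.exp (-u) - (q.totient : ℝ)⁻¹ : ℝ) : ℂ) *
          Complex.exp (-s * u) = ((A a (Real.exp u) * Real.exp (-u) : ℝ) : ℂ) * Complex.exp (-s * u)
          - (q.totient : ℂ)⁻¹ * Complex.exp (-s * u) := fun u => by
        push_cast; ring
      simp_rw [e]
      rw [integral_sub, A_laplace ha s hs, integral_const_mul, hE]
      · field_simp
        ring
      · refine hexp.bdd_mul (c := Real.log 4 + 4) ?_ (Eventually.of_forall fun u => ?_)
        · exact (Complex.measurable_ofReal.comp hBm).aestronglyMeasurable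
        · rw [Complex.norm_real, Real.norm_of_nonneg (hB0 u)]
          exact hBM u
      · exact hexp.const_mul _
  refine (key.comp Real.tendsto_log_atTop).congr' ?_
  filter_upwards [eventually_gt_atTop 0] with x hx
  simp only [Function.comp]
  rw [Real.exp_neg, Real.exp_log hx, div_eq_mul_inv]

open Classical in
/-- primes up to `N` in a residue class -/
noncomputable def PA (a : ZMod q) (N : ℕ) : Finset ℕ :=
  (Nat.primesLE N).filter fun p : ℕ => (p : ZMod q) = a

lemma A_sub_theta (N : ℕ) : 0 ≤ A a N - ∑ p ∈ PA a N, Real.log p ∧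
    A a N - ∑ p ∈ PA a N, Real.log p ≤ Chebyshev.psi N - Chebyshev.theta N := by
  classical
  have e : A a N - ∑ p ∈ PA a N, Real.log p =
      ∑ n ∈ Finset.Icc 1 N, if n.Prime then 0 else residueClass a n := by
    have : ∑ p ∈ PA a N, Real.log p =
        ∑ n ∈ Finset.Icc 1 N, if n.Prime then residueClass a n else 0 := by
      rw [← Finset.sum_filter]
      have : PA a N = (Finset.filter Nat.Prime (Finset.Icc 1 N)).filter
          fun p : ℕ => (p : ZMod q) = a := by
        ext p
        simp only [PA, Finset.mem_filter, Nat.mem_primesLE, Finset.mem_Icc]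
        constructor
        · rintro ⟨⟨h1, h2⟩, h3⟩; exact ⟨⟨⟨h2.one_le, h1⟩, h2⟩, h3⟩
        · rintro ⟨⟨⟨h2, h1⟩, h4⟩, h3⟩; exact ⟨⟨h1, h4⟩, h3⟩
      rw [this, Finset.sum_filter]
      refine Finset.sum_congr rfl fun p hp => ?_
      rw [Finset.mem_filter] at hp
      simp only [residueClass, indicator, mem_ofPred_eq, vonMangoldt_apply_prime hp.2]
    rw [this]
    simp only [A, Nat.floor_natCast]
    rw [← Finset.sum_sub_distrib]
    refine Finset.sum_congr rfl fun n _ => ?_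
    split_ifs <;> simp
  rw [e]
  constructor
  · refine Finset.sum_nonneg fun n _ => ?_
    split_ifs
    · rfl
    · exact residueClass_nonneg a n
  · rw [Chebyshev.psi_sub_theta_eq_sum_not_prime, Nat.floor_natCast, Finset.sum_filter]
    refine Finset.sum_le_sum fun n _ => ?_
    split_ifs
    · rfl
    · exact residueClass_le a n

lemma PA_sub (N : ℕ) (hN : 2 ≤ N) :
    0 ≤ ((PA a N).card : ℝ) - (∑ p ∈ PA a N, Real.log p) / Real.log N ∧
    ((PA a N).card : ℝ) - (∑ p ∈ PA a N, Real.log p) / Real.log N ≤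
      Nat.primeCounting N - Chebyshev.theta N / Real.log N := by
  have hlog : 0 < Real.log N := Real.log_pos (by exact_mod_cast hN)
  have e : ∀ S : Finset ℕ, (S.card : ℝ) - (∑ p ∈ S, Real.log p) / Real.log N =
      ∑ p ∈ S, (1 - Real.log p / Real.log N) := fun S => by
    rw [Finset.sum_sub_distrib, Finset.sum_div]; simp
  have hnn : ∀ p ∈ Nat.primesLE N, 0 ≤ 1 - Real.log p / Real.log N := fun p hp => by
    rw [Nat.mem_primesLE] at hp
    rw [sub_nonneg, div_le_one hlog]
    exact Real.log_le_log (by exact_mod_cast hp.2.pos) (by exact_mod_cast hp.1)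
  rw [Chebyshev.theta_eq_sum_primesLE_log, ← Nat.primesLE_card_eq_primeCounting, e, e]
  constructor
  · exact Finset.sum_nonneg fun p hp => hnn p (Finset.filter_subset _ _ hp)
  · exact Finset.sum_le_sum_of_subset_of_nonneg (Finset.filter_subset _ _) fun p hp _ => hnn p hp

theorem PA_tendsto (ha : IsUnit a) :
    Tendsto (fun N : ℕ => ((PA a N).card : ℝ) * Real.log N / N) atTop (𝓝 ((q.totient : ℝ)⁻¹)) := by
  have hc := tendsto_natCast_atTop_atTop (R := ℝ)
  have h1 := (A_tendsto ha).comp hc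
  have h2 : Tendsto (fun N : ℕ => (Chebyshev.psi N - Chebyshev.theta N) / N) atTop (𝓝 0) := by
    have : (Chebyshev.psi - Chebyshev.theta) =o[atTop] (fun x : ℝ => x) := by
      refine Chebyshev.isBigO_psi_sub_theta_sqrt.trans_isLittleO ?_
      refine (Asymptotics.isLittleO_iff_tendsto' ?_).2 ?_
      · filter_upwards [eventually_gt_atTop 0] with x hx h
        exact absurd h hx.ne'
      · refine (Real.tendsto_sqrt_atTop.inv_tendsto_atTop).congr' ?_
        filter_upwards [eventually_gt_atTop 0] with x hx
        simp only [Pi.inv_apply]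
        rw [Real.sqrt_div_self', one_div]
    exact this.tendsto_div_nhds_zero.comp hc
  have h3 : Tendsto (fun N : ℕ => (Nat.primeCounting N - Chebyshev.theta N / Real.log N) *
      Real.log N / N) atTop (𝓝 0) := by
    have h : (fun x : ℝ => (Nat.primeCounting ⌊x⌋₊ : ℝ) - Chebyshev.theta x / Real.log x)
        =o[atTop] (fun x : ℝ => x / Real.log x) := by
      refine Chebyshev.primeCounting_sub_theta_div_log_isBigO.trans_isLittleO ?_
      refine Asymptotics.isLittleO_iff_tendsto' (by simp) |>.mpr ?_
      refine Tendsto.congr' (f₁ := fun x ↦ (Real.log x)⁻¹) ?_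
        Real.tendsto_log_atTop.inv_tendsto_atTop
      filter_upwards [eventually_gt_atTop 0] with x _
      field
    refine (h.tendsto_div_nhds_zero.comp hc).congr fun N => ?_
    simp only [Function.comp, Nat.floor_natCast]
    rw [div_div_eq_mul_div]
  have h4 : Tendsto (fun N : ℕ => (A a N - ∑ p ∈ PA a N, Real.log p) / N) atTop (𝓝 0) := by
    refine squeeze_zero (fun N => ?_) (fun N => ?_) h2
    · exact div_nonneg (A_sub_theta N).1 (by positivity)
    · exact div_le_div_of_nonneg_right (A_sub_theta N).2 (by positivity)
  have h5 : Tendsto (fun N : ℕ => (((PA a N).card : ℝ) - (∑ p ∈ PA a N, Real.log p) / Real.log N) *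
      Real.log N / N) atTop (𝓝 0) := by
    refine squeeze_zero' ?_ ?_ h3
    · filter_upwards [eventually_ge_atTop 2] with N hN
      have := (PA_sub (a := a) N hN).1
      have hlog : 0 < Real.log N := Real.log_pos (by exact_mod_cast hN)
      positivity
    · filter_upwards [eventually_ge_atTop 2] with N hN
      have := (PA_sub (a := a) N hN).2
      have hlog : 0 < Real.log N := Real.log_pos (by exact_mod_cast hN)
      gcongr
  have h6 := (h1.sub h4).add h5
  rw [sub_zero, add_zero] at h6
  refine h6.congr' ?_
  filter_upwards [eventually_ge_atTop 2] with N hN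
  have hlog : 0 < Real.log N := Real.log_pos (by exact_mod_cast hN)
  have hN' : (0:ℝ) < N := by exact_mod_cast (by omega : 0 < N)
  simp only [Function.comp]
  field_simp
  ring
end ap
lemma exists_theta0 (K L : Type*) [Field K] [Field L] [Algebra K L] [FiniteDimensional K L]
    [IsGalois K L] (H : Subgroup Gal(L/K)) :
    ∃ a : L, ∀ σ : Gal(L/K), σ a = a ↔ σ ∈ H := by
  obtain ⟨a, ha⟩ := Field.exists_primitive_element K (IntermediateField.fixedField H)
  have ha' : IntermediateField.adjoin K {(a : L)} = IntermediateField.fixedField H := by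
    rw [← IntermediateField.lift_adjoin_simple, ha, IntermediateField.lift_top]
  clear ha
  generalize (a : L) = b at ha'
  refine ⟨b, fun σ => ?_⟩
  rw [← IntermediateField.fixingSubgroup_fixedField H, ← Subgroup.zpowers_le,
    ← IntermediateField.le_iff_le, ← ha', IntermediateField.adjoin_simple_le_iff]
  constructor
  · intro h
    rintro ⟨τ, hτ⟩
    have : Subgroup.zpowers σ ≤ MulAction.stabilizer Gal(L/K) b := by
      rw [Subgroup.zpowers_le]; exact h
    exact this hτ
  · intro h
    exact h ⟨σ, Subgroup.mem_zpowers σ⟩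

open NumberField in
lemma exists_theta (L : Type*) [Field L] [NumberField L] [IsGalois ℚ L] (H : Subgroup Gal(L/ℚ)) :
    ∃ θ : 𝓞 L, ∀ σ : Gal(L/ℚ), σ • θ = θ ↔ σ ∈ H := by
  obtain ⟨a, ha⟩ := exists_theta0 ℚ L H
  have halg : IsAlgebraic ℤ (a : L) :=
    (IsFractionRing.isAlgebraic_iff ℤ ℚ L).mpr (Algebra.IsAlgebraic.isAlgebraic (R := ℚ) (a:L))
  obtain ⟨k, hk, hkint⟩ := halg.exists_integral_multiple
  obtain ⟨θ, hθ⟩ : ∃ θ : 𝓞 L, (θ : L) = k • a := ⟨⟨k • a, hkint⟩, rfl⟩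
  refine ⟨θ, fun σ => ?_⟩
  rw [← ha σ, RingOfIntegers.ext_iff]
  have : ((σ • θ : 𝓞 L) : L) = k • σ (a : L) := by
    change σ (θ : L) = _
    rw [hθ, map_zsmul]
  rw [this, hθ, smul_right_inj hk]

open NumberField in
/-- Frobenius data at a prime. -/
lemma exists_frob (m : ℕ) [NeZero m] (L : Type*) [Field L] [NumberField L] 
    [IsCyclotomicExtension {m} ℚ L] (p : ℕ) (hp : p.Prime) (hpm : p.Coprime m) :
    ∃ (Q : Ideal (𝓞 L)) (σ : Gal(L/ℚ)), Q.IsPrime ∧ (∀ k : ℤ, (k : 𝓞 L) ∈ Q ↔ (p : ℤ) ∣ k) ∧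
      (∀ x : 𝓞 L, σ • x - x ^ p ∈ Q) ∧ 
      IsCyclotomicExtension.Rat.galEquivZMod m L σ = ZMod.unitOfCoprime p hpm := by
  have : IsGalois ℚ L := IsCyclotomicExtension.isGalois {m} ℚ L
  have hpp : (Ideal.span {(p : ℤ)}).IsPrime := 
    (Ideal.span_singleton_prime (by exact_mod_cast hp.ne_zero)).2 (Nat.prime_iff_prime_int.1 hp)
  obtain ⟨⟨Q, hQ⟩⟩ := (Ideal.span {(p : ℤ)}).nonempty_primesOver (S := 𝓞 L)
  have hQ1 : Q.IsPrime := hQ.1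
  have hover : Q.under ℤ = Ideal.span {(p : ℤ)} := (hQ.2.over).symm
  have hmem : ∀ k : ℤ, (k : 𝓞 L) ∈ Q ↔ (p : ℤ) ∣ k := by
    intro k
    rw [← Ideal.mem_span_singleton, ← hover, Ideal.mem_comap]; rfl
  have hQne : Q ≠ ⊥ := by
    rintro rfl
    have := (hmem p).2 dvd_rfl
    rw [Ideal.mem_bot] at this
    have h2 : (p : 𝓞 L) = 0 := by exact_mod_cast this
    exact hp.ne_zero (by exact_mod_cast h2)
  have : Finite (𝓞 L ⧸ Q) := Ring.HasFiniteQuotients.finiteQuotient hQne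
  obtain ⟨σ, hσ⟩ := IsArithFrobAt.exists_of_isInvariant ℤ Gal(L/ℚ) Q
  have hcard : Nat.card (ℤ ⧸ Q.under ℤ) = p := by rw [hover, Int.card_ideal_quot]
  refine ⟨Q, σ, hQ1, hmem, fun x => ?_, ?_⟩
  · have := hσ x
    rw [hcard] at this
    exact this
  · have hζ := IsCyclotomicExtension.zeta_spec m ℚ L
    have h1 := hζ.toInteger_isPrimitiveRoot
    have h2 : (m : 𝓞 L) ∉ Q := by
      intro h
      have := (hmem m).1 (by exact_mod_cast h)
      have h3 : p ∣ m := by exact_mod_cast this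
      exact hp.one_lt.ne' (hpm.eq_one_of_dvd h3)
    have h3 := AlgHom.IsArithFrobAt.apply_of_pow_eq_one hσ h1.pow_eq_one h2
    rw [hcard] at h3
    have h4 : σ • hζ.toInteger = hζ.toInteger ^ p := h3
    rw [IsCyclotomicExtension.Rat.galEquivZMod_smul_of_pow_eq m L σ h1.pow_eq_one] at h4
    have := (h1.isOfFinOrder (NeZero.ne _)).pow_inj_mod.1 h4
    rw [← h1.eq_orderOf, ← ZMod.natCast_eq_natCast_iff', ZMod.natCast_zmod_val] at this
    exact Units.ext this

open NumberField in
/-- Polynomial whose prime divisors are, up to finitely many, those in a subgroup mod `m`. -/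
lemma exists_poly0 (m : ℕ) [NeZero m] (L : Type*) [Field L] [NumberField L]
    [IsCyclotomicExtension {m} ℚ L] (H : Subgroup (ZMod m)ˣ) :
    ∃ (f : ℤ[X]) (N0 : ℕ), ∀ p : ℕ, p.Prime → N0 < p → ∀ h : p.Coprime m,
      ((∃ n : ℤ, (p : ℤ) ∣ f.eval n) ↔ ZMod.unitOfCoprime p h ∈ H) := by
  classical
  have : IsGalois ℚ L := IsCyclotomicExtension.isGalois {m} ℚ L
  let e := IsCyclotomicExtension.Rat.galEquivZMod m L
  have hcomm : ∀ σ τ : Gal(L/ℚ), σ * τ = τ * σ := fun σ τ => by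
    apply e.injective; rw [map_mul, map_mul, mul_comm]
  obtain ⟨θ, hθ⟩ := exists_theta L (H.comap e.toMonoidHom)
  have hθ' : ∀ σ : Gal(L/ℚ), σ • θ = θ ↔ e σ ∈ H := hθ
  obtain ⟨f, hf⟩ := (mem_lifts _).mp (Algebra.IsInvariant.charpoly_mem_lifts ℤ (𝓞 L) Gal(L/ℚ) θ)
  have hfe : ∀ n : ℤ, ((f.eval n : ℤ) : 𝓞 L) = ∏ g : Gal(L/ℚ), ((n : 𝓞 L) - g • θ) := by
    intro n
    have h1 : (f.map (algebraMap ℤ (𝓞 L))).eval (algebraMap ℤ (𝓞 L) n) =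
        algebraMap ℤ (𝓞 L) (f.eval n) := eval_map_apply _ _
    rw [hf, MulSemiringAction.charpoly_eq, eval_prod] at h1
    simpa using h1.symm
  -- the bad primes
  let x : 𝓞 L := ∏ τ ∈ (Finset.univ.filter fun τ : Gal(L/ℚ) => e τ ∉ H),
    ∏ g : Gal(L/ℚ), (τ • (g • θ) - g • θ)
  have hx : x ≠ 0 := by
    refine Finset.prod_ne_zero_iff.2 fun τ hτ => Finset.prod_ne_zero_iff.2 fun g _ hg => ?_
    rw [Finset.mem_filter] at hτ
    apply hτ.2
    rw [← hθ']
    rw [sub_eq_zero, smul_smul, hcomm, mul_smul] at hg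
    exact smul_left_cancel g hg
  have hxi : IsIntegral ℤ x := Algebra.IsIntegral.isIntegral x
  have hne := Ideal.comap_ne_bot_of_integral_mem (R := ℤ) hx (Ideal.mem_span_singleton_self x) hxi
  obtain ⟨k, hk, hk0⟩ := Submodule.exists_mem_ne_zero_of_ne_bot hne
  have hk : x ∣ (k : 𝓞 L) := by
    rw [Ideal.mem_comap, Ideal.mem_span_singleton] at hk
    simpa using hk
  refine ⟨f, k.natAbs, fun p hp hpk hpm => ?_⟩
  obtain ⟨Q, σ, hQ, hQmem, hσ, heσ⟩ := exists_frob m L p hp hpm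
  change e σ = _ at heσ
  rw [← heσ]
  constructor
  · rintro ⟨n, hn⟩
    by_contra hcon
    have h1 := (hQmem _).2 hn
    rw [hfe, hQ.prod_mem_iff] at h1
    obtain ⟨g, -, hg⟩ := h1
    have h2 : σ • (g • θ) - g • θ ∈ Q := by
      have h3 : (n : 𝓞 L) ^ p - (g • θ) ^ p ∈ Q := Ideal.mem_of_dvd Q (sub_dvd_pow_sub_pow _ _ _) hg
      have h4 : (((n ^ p - n : ℤ)) : 𝓞 L) ∈ Q := by
        rw [hQmem]
        have := Fact.mk hp
        rw [← ZMod.intCast_zmod_eq_zero_iff_dvd]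
        simp
      have h5 := hσ (g • θ)
      push_cast at h4
      have : σ • (g • θ) - g • θ = (σ • (g • θ) - (g • θ) ^ p) - ((n : 𝓞 L) ^ p - (g • θ) ^ p)
        + ((n : 𝓞 L) ^ p - n) + (n - g • θ) := by ring
      rw [this]
      exact Q.add_mem (Q.add_mem (Q.sub_mem h5 h3) h4) hg
    have hxQ : x ∈ Q := by
      refine Ideal.mem_of_dvd Q ?_ h2
      refine dvd_trans ?_ (Finset.dvd_prod_of_mem _ (Finset.mem_filter.2 ⟨Finset.mem_univ σ, hcon⟩))
      exact Finset.dvd_prod_of_mem _ (Finset.mem_univ g)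
    have := (hQmem k).1 (Ideal.mem_of_dvd Q hk hxQ)
    have h6 := Nat.le_of_dvd (Int.natAbs_pos.2 hk0) (Int.natCast_dvd.1 this)
    omega
  · intro hmem
    have h1 := (hθ' σ).2 hmem
    have h2 := hσ θ
    rw [h1] at h2
    have := Fact.mk hp
    have hmk : ∀ y : 𝓞 L, Ideal.Quotient.mk Q y = 0 ↔ y ∈ Q := fun y => Ideal.Quotient.eq_zero_iff_mem
    let F := FractionRing (𝓞 L ⧸ Q)
    let φ : 𝓞 L →+* F := (algebraMap (𝓞 L ⧸ Q) F).comp (Ideal.Quotient.mk Q)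
    have hφ : ∀ y, φ y = 0 ↔ y ∈ Q := fun y => by
      rw [RingHom.comp_apply, FaithfulSMul.algebraMap_eq_zero_iff, hmk]
    have : CharP F p := by
      refine ⟨fun a => ?_⟩
      have := hφ a
      rw [map_natCast] at this
      rw [this]
      have := hQmem a
      exact_mod_cast this
    have h3 : (φ θ) ^ p = φ θ := by
      have := (hφ _).2 h2
      rw [map_sub, map_pow, sub_eq_zero] at this
      exact this.symm
    rw [← Subfield.mem_bot_iff_pow_eq_self F p] at h3
    obtain ⟨n, hn⟩ : ∃ n : ℤ, (n : F) = φ θ := (mem_bot_iff_intCast p F).1 h3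
    refine ⟨n, (hQmem _).1 ?_⟩
    rw [hfe, hQ.prod_mem_iff]
    refine ⟨1, Finset.mem_univ _, ?_⟩
    rw [← hφ, one_smul, map_sub, ← hn, map_intCast, sub_self]

lemma exists_poly (m : ℕ) [NeZero m] (H : Subgroup (ZMod m)ˣ) :
    ∃ (f : ℤ[X]) (N0 : ℕ), ∀ p : ℕ, p.Prime → N0 < p → ∀ h : p.Coprime m,
      ((∃ n : ℤ, (p : ℤ) ∣ f.eval n) ↔ ZMod.unitOfCoprime p h ∈ H) := by
  have h : @IsCyclotomicExtension {m} ℚ (CyclotomicField m ℚ) _ _ DivisionRing.toRatAlgebra := by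
    have h0 := CyclotomicField.isCyclotomicExtension m ℚ
    convert h0
    · rfl
    · exact Subsingleton.elim (α := Algebra ℚ (CyclotomicField m ℚ)) _ _
  exact exists_poly0 m (CyclotomicField m ℚ) H

lemma exists_sub (q n : ℕ) (hq : q.Prime) (hn : n ∣ q - 1) :
    ∃ H : Subgroup (ZMod q)ˣ, Nat.card H * n = q - 1 := by
  have := Fact.mk hq
  have hc : Nat.card (ZMod q)ˣ = q - 1 := by
    rw [Nat.card_eq_fintype_card, ZMod.card_units_eq_totient, Nat.totient_prime hq]
  refine ⟨(powMonoidHom n : (ZMod q)ˣ →* (ZMod q)ˣ).range, ?_⟩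
  have h1 := (powMonoidHom n : (ZMod q)ˣ →* (ZMod q)ˣ).range.card_mul_index
  rw [IsCyclic.index_powMonoidHom_range, hc, Nat.gcd_eq_right hn] at h1
  exact h1

lemma exists_data (c : ℕ) (hc : 0 < c) (d : ℕ) :
    ∃ (m : ℕ) (_ : NeZero m) (T : Finset (ZMod m)) (P : ℤ[X]) (N0 : ℕ), m ≤ N0 ∧
      (∀ a ∈ T, IsUnit a) ∧ T.card * (c + d) = c * m.totient ∧
      ∀ p : ℕ, p.Prime → N0 < p → ((∃ n : ℤ, (p : ℤ) ∣ P.eval n) ↔ (p : ZMod m) ∉ T) := by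
  classical
  induction d with
  | zero =>
    refine ⟨1, inferInstance, Finset.univ, 1, 1, le_rfl, fun a _ => ?_, by simp, fun p hp _ => ?_⟩
    · rw [Subsingleton.elim a 1]; exact isUnit_one
    · simp only [eval_one, Finset.mem_univ, not_true_eq_false, iff_false, not_exists]
      intro _ h
      have : p ∣ 1 := by exact_mod_cast h
      exact hp.one_lt.ne' (Nat.dvd_one.1 this)
  | succ d ih =>
    obtain ⟨m, hm, T, P, N0, hmN, hT, hcard, hP⟩ := ih
    obtain ⟨q, hq, hqN, hqmod⟩ := Nat.exists_prime_gt_modEq_one (k := c + d + 1) N0 (by omega)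
    have hqd : (c + d + 1) ∣ q - 1 := (Nat.modEq_iff_dvd' hq.one_le).1 hqmod.symm
    obtain ⟨H, hH⟩ := exists_sub q (c + d + 1) hq hqd
    have : NeZero q := ⟨hq.ne_zero⟩
    have hcop : m.Coprime q := by
      refine ((Nat.Prime.coprime_iff_not_dvd hq).2 fun h => ?_).symm
      have := Nat.le_of_dvd (Nat.pos_of_ne_zero hm.out) h
      omega
    obtain ⟨f, N1, hf⟩ := exists_poly q H
    let U : Finset (ZMod q) := (Finset.univ.filter fun u : (ZMod q)ˣ => u ∉ H).map
      ⟨Units.val, Units.val_injective⟩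
    have hU : U.card + Nat.card H = q - 1 := by
      have hc : Fintype.card (ZMod q)ˣ = q - 1 := by
        rw [ZMod.card_units_eq_totient, Nat.totient_prime hq]
      rw [Finset.card_map, ← hc, ← Finset.card_univ,
        ← Finset.card_filter_add_card_filter_not (s := Finset.univ) (fun u : (ZMod q)ˣ => u ∈ H),
        Nat.card_eq_fintype_card, Fintype.card_subtype, add_comm]
    have hUmem : ∀ p : ℕ, ∀ h : p.Coprime q, (p : ZMod q) ∈ U ↔ ZMod.unitOfCoprime p h ∉ H := by
      intro p h
      rw [Finset.mem_map]
      constructor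
      · rintro ⟨u, hu, hup⟩
        rw [Finset.mem_filter] at hu
        have : u = ZMod.unitOfCoprime p h := Units.ext hup
        rw [← this]; exact hu.2
      · intro hn
        exact ⟨ZMod.unitOfCoprime p h, Finset.mem_filter.2 ⟨Finset.mem_univ _, hn⟩, rfl⟩
    let e := ZMod.chineseRemainder hcop
    refine ⟨m * q, ⟨Nat.mul_ne_zero hm.out hq.ne_zero⟩, (T ×ˢ U).map e.symm.toEquiv.toEmbedding,
      P * f, max (m * q) (max N0 N1), le_max_left _ _, ?_, ?_, ?_⟩
    · intro a ha
      rw [Finset.mem_map] at ha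
      obtain ⟨⟨t, u⟩, htu, rfl⟩ := ha
      rw [Finset.mem_product] at htu
      have hu : IsUnit u := by
        obtain ⟨v, -, hv⟩ := Finset.mem_map.1 htu.2
        exact ⟨v, hv⟩
      have : IsUnit ((t, u) : ZMod m × ZMod q) := Prod.isUnit_iff.2 ⟨hT t htu.1, hu⟩
      exact this.map e.symm
    · rw [Finset.card_map, Finset.card_product, Nat.totient_mul hcop, Nat.totient_prime hq]
      have h1 : U.card * (c + d + 1) = (q - 1) * (c + d) := by
        have : (U.card + Nat.card H) * (c + d + 1) = (q - 1) * (c + d + 1) := by rw [hU]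
        rw [add_mul, hH] at this
        have h2 : (q - 1) * (c + d + 1) = (q - 1) * (c + d) + (q - 1) := by ring
        omega
      calc T.card * U.card * (c + (d + 1)) = T.card * (U.card * (c + d + 1)) := by ring
        _ = T.card * (c + d) * (q - 1) := by rw [h1]; ring
        _ = _ := by rw [hcard]; ring
    · intro p hp hpN
      have hpq : p.Coprime q := by
        rw [Nat.coprime_primes hp hq]
        rintro rfl
        have : p ≤ m * p := Nat.le_mul_of_pos_left _ (Nat.pos_of_ne_zero hm.out)
        have := le_max_left (m * p) (max N0 N1)
        omega
      have hN0 : N0 < p := lt_of_le_of_lt ((le_max_left _ _).trans (le_max_right _ _)) hpN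
      have hN1 : N1 < p := lt_of_le_of_lt ((le_max_right _ _).trans (le_max_right _ _)) hpN
      have hmem : (p : ZMod (m * q)) ∈ (T ×ˢ U).map e.symm.toEquiv.toEmbedding ↔
          (p : ZMod m) ∈ T ∧ (p : ZMod q) ∈ U := by
        have he : e.symm ((p : ZMod m), (p : ZMod q)) = (p : ZMod (m * q)) := by
          rw [RingEquiv.symm_apply_eq, map_natCast]; rfl
        rw [← he]
        exact (Finset.mem_map' _).trans Finset.mem_product
      rw [hmem, not_and_or, ← hP p hp hN0, hUmem p hpq, not_not, ← hf p hp hN1 hpq, ← exists_or]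
      refine exists_congr fun n => ?_
      rw [eval_mul, (Nat.prime_iff_prime_int.1 hp).dvd_mul]

lemma natCard_eq (A : ℕ → Prop) [DecidablePred A] (N : ℕ) :
    Nat.card {p : ℕ | p ≤ N ∧ p.Prime ∧ A p} = ((Nat.primesLE N).filter A).card := by
  have : {p : ℕ | p ≤ N ∧ p.Prime ∧ A p} = ((Nat.primesLE N).filter A : Finset ℕ) := by
    ext p; simp [Nat.mem_primesLE, and_assoc]
  rw [this, Nat.card_coe_set_eq, Set.ncard_coe_finset]

lemma natCard_eq' (N : ℕ) :
    Nat.card {p : ℕ | p ≤ N ∧ p.Prime} = (Nat.primesLE N).card := by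
  have : {p : ℕ | p ≤ N ∧ p.Prime} = (Nat.primesLE N : Finset ℕ) := by
    ext p; simp [Nat.mem_primesLE]
  rw [this, Nat.card_coe_set_eq, Set.ncard_coe_finset]

lemma pi_tendsto :
    Tendsto (fun N : ℕ => ((Nat.primesLE N).card : ℝ) * Real.log N / N) atTop (𝓝 1) := by
  have h := PA_tendsto (q := 1) (a := 1) isUnit_one
  have h2 : ∀ N, PA (1 : ZMod 1) N = Nat.primesLE N := by
    intro N
    unfold PA
    exact Finset.filter_true_of_mem fun p _ => Subsingleton.elim _ _
  simpa [h2] using h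

open Classical in
lemma T_tendsto {m : ℕ} [NeZero m] (T : Finset (ZMod m)) (hT : ∀ a ∈ T, IsUnit a) :
    Tendsto (fun N : ℕ => (((Nat.primesLE N).filter fun p : ℕ => (p : ZMod m) ∈ T).card : ℝ)
      * Real.log N / N) atTop (𝓝 (T.card * (m.totient : ℝ)⁻¹)) := by
  have h1 : Tendsto (fun N : ℕ => ∑ a ∈ T, ((PA a N).card : ℝ) * Real.log N / N) atTop
      (𝓝 (∑ a ∈ T, (m.totient : ℝ)⁻¹)) := tendsto_finsetSum _ fun a ha => PA_tendsto (hT a ha)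
  rw [Finset.sum_const, nsmul_eq_mul] at h1
  refine h1.congr fun N => ?_
  rw [← Finset.sum_div, ← Finset.sum_mul]
  congr 2
  have h2 := Finset.card_eq_sum_card_fiberwise (f := fun p : ℕ => (p : ZMod m)) (t := T)
    (s := (Nat.primesLE N).filter fun p : ℕ => (p : ZMod m) ∈ T)
    (fun p hp => (Finset.mem_filter.1 hp).2)
  rw [h2]
  push_cast
  refine Finset.sum_congr rfl fun a ha => ?_
  congr 2
  ext p
  simp only [PA, Finset.mem_filter]
  constructor
  · rintro ⟨h, rfl⟩; exact ⟨⟨h, ha⟩, rfl⟩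
  · rintro ⟨⟨h, -⟩, h2⟩; exact ⟨h, h2⟩

open Classical in
lemma density_of_data {m : ℕ} [NeZero m] (T : Finset (ZMod m)) (hT : ∀ a ∈ T, IsUnit a)
    (A : ℕ → Prop) (N0 : ℕ) (hA : ∀ p : ℕ, p.Prime → N0 < p → (A p ↔ (p : ZMod m) ∉ T)) :
    Tendsto (fun N : ℕ => (((Nat.primesLE N).filter A).card : ℝ) / (Nat.primesLE N).card)
      atTop (𝓝 (1 - T.card * (m.totient : ℝ)⁻¹)) := by
  set B : ℕ → ℝ := fun N => ((Nat.primesLE N).filter fun p : ℕ => (p : ZMod m) ∈ T).card with hB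
  set D : ℕ → ℝ := fun N => ((Nat.primesLE N).filter A).card with hD
  set G : ℕ → ℝ := fun N => (Nat.primesLE N).card with hG
  have hE : ∀ N, |D N - (G N - B N)| ≤ N0 + 1 := by
    intro N
    have h0 : G N = D N + ((Nat.primesLE N).filter fun p => ¬ A p).card := by
      simp only [hG, hD]
      rw [← Finset.card_filter_add_card_filter_not (s := Nat.primesLE N) A]
      push_cast
      rfl
    have h1 : B N ≤ ((Nat.primesLE N).filter fun p => ¬ A p).card + (N0 + 1) := by
      have : ((Nat.primesLE N).filter fun p : ℕ => (p : ZMod m) ∈ T) ⊆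
          ((Nat.primesLE N).filter fun p => ¬ A p) ∪ Finset.range (N0 + 1) := by
        intro p hp
        rw [Finset.mem_filter] at hp
        rw [Finset.mem_union, Finset.mem_filter, Finset.mem_range]
        by_cases h : N0 < p
        · left
          refine ⟨hp.1, ?_⟩
          rw [hA p (Nat.mem_primesLE.1 hp.1).2 h, not_not]
          exact hp.2
        · right; omega
      have := (Finset.card_le_card this).trans (Finset.card_union_le _ _)
      rw [Finset.card_range] at this
      simp only [hB]
      exact_mod_cast this
    have h2 : (((Nat.primesLE N).filter fun p => ¬ A p).card : ℝ) ≤ B N + (N0 + 1) := by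
      have : ((Nat.primesLE N).filter fun p => ¬ A p) ⊆
          ((Nat.primesLE N).filter fun p : ℕ => (p : ZMod m) ∈ T) ∪ Finset.range (N0 + 1) := by
        intro p hp
        rw [Finset.mem_filter] at hp
        rw [Finset.mem_union, Finset.mem_filter, Finset.mem_range]
        by_cases h : N0 < p
        · left
          refine ⟨hp.1, ?_⟩
          have := hp.2
          rw [hA p (Nat.mem_primesLE.1 hp.1).2 h, not_not] at this
          exact this
        · right; omega
      have := (Finset.card_le_card this).trans (Finset.card_union_le _ _)
      rw [Finset.card_range] at this
      simp only [hB]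
      exact_mod_cast this
    rw [abs_le]
    constructor <;> linarith
  have hlog : Tendsto (fun N : ℕ => Real.log N / N) atTop (𝓝 0) :=
    (Real.isLittleO_log_id_atTop.tendsto_div_nhds_zero).comp tendsto_natCast_atTop_atTop
  have hE0 : Tendsto (fun N : ℕ => (D N - (G N - B N)) * (Real.log N / N)) atTop (𝓝 0) := by
    have h3 : Tendsto (fun N : ℕ => ((N0 : ℝ) + 1) * |Real.log N / N|) atTop (𝓝 0) := by
      simpa using hlog.abs.const_mul ((N0 : ℝ) + 1)
    refine squeeze_zero_norm (fun N => ?_) h3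
    rw [norm_mul, Real.norm_eq_abs, Real.norm_eq_abs]
    exact mul_le_mul_of_nonneg_right (hE N) (abs_nonneg _)
  have hDt : Tendsto (fun N : ℕ => D N * (Real.log N / N)) atTop
      (𝓝 (1 - T.card * (m.totient : ℝ)⁻¹)) := by
    have := (pi_tendsto.sub (T_tendsto T hT)).add hE0
    rw [add_zero] at this
    refine this.congr fun N => ?_
    simp only [hB, hD, hG]
    ring
  have hGt : Tendsto (fun N : ℕ => G N * (Real.log N / N)) atTop (𝓝 1) :=
    pi_tendsto.congr fun N => by simp only [hG]; ring
  have := hDt.div hGt one_ne_zero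
  rw [div_one] at this
  refine this.congr' ?_
  filter_upwards [eventually_ge_atTop 2] with N hN
  have hN' : (1 : ℝ) < N := by exact_mod_cast hN
  have : Real.log N / N ≠ 0 := (div_pos (Real.log_pos hN') (by linarith)).ne'
  simp only [Pi.div_apply]
  exact mul_div_mul_right _ _ this

end DS

theorem density_surjective (r : ℚ) (h0 : 0 ≤ r) (h1 : r ≤ 1) :
    ∃ P : Polynomial ℤ,
      Filter.Tendsto (fun x : ℕ =>
          (Nat.card {p : ℕ | p ≤ x ∧ p.Prime ∧ ∃ n : ℤ, (p : ℤ) ∣ P.eval n} : ℝ) /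
            (Nat.card {p : ℕ | p ≤ x ∧ p.Prime} : ℝ))
        Filter.atTop (nhds (r : ℝ)) := by
  classical
  simp only [DS.natCard_eq, DS.natCard_eq']
  rcases h1.eq_or_lt with rfl | h1
  · refine ⟨0, ?_⟩
    refine tendsto_const_nhds.congr' ?_
    filter_upwards [eventually_ge_atTop 2] with N hN
    have : (Nat.primesLE N).card ≠ 0 :=
      Finset.card_ne_zero_of_mem (Nat.mem_primesLE.2 ⟨hN, Nat.prime_two⟩)
    have h2 : ((Nat.primesLE N).card : ℝ) ≠ 0 := by exact_mod_cast this
    have h3 : ((Nat.primesLE N).filter fun p : ℕ => ∃ n : ℤ, (p : ℤ) ∣ (0 : ℤ[X]).eval n) =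
        Nat.primesLE N := Finset.filter_true_of_mem fun p _ => ⟨0, by simp⟩
    rw [h3, div_self h2, Rat.cast_one]
  · have hpos : 0 < (1 - r).num := Rat.num_pos.2 (by linarith)
    have hle : (1 - r).num ≤ (1 - r).den := by
      have : (1 - r) ≤ 1 := by linarith
      rw [← Rat.num_div_den (1 - r), div_le_one (by exact_mod_cast (1 - r).den_pos)] at this
      exact_mod_cast this
    obtain ⟨c, hc⟩ := Int.eq_ofNat_of_zero_le hpos.le
    obtain ⟨d, hd⟩ := Nat.exists_eq_add_of_le (show c ≤ (1 - r).den by omega)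
    obtain ⟨m, hm, T, P, N0, -, hT, hcard, hP⟩ := DS.exists_data c (by omega) d
    refine ⟨P, ?_⟩
    have h := DS.density_of_data T hT (fun p => ∃ n : ℤ, (p : ℤ) ∣ P.eval n) N0 hP
    have hr : (r : ℝ) = 1 - T.card * (m.totient : ℝ)⁻¹ := by
      have e1 : (1 - r : ℚ) = c / ((c + d : ℕ) : ℚ) := by
        rw [← hd]
        conv_lhs => rw [← Rat.num_div_den (1 - r), hc]
        simp
      have e2 : (1 - r : ℝ) = c / ((c + d : ℕ) : ℝ) := by
        have := congrArg (Rat.cast : ℚ → ℝ) e1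
        push_cast at this ⊢
        exact this
      have e3 : (T.card : ℝ) * (c + d : ℕ) = c * m.totient := by exact_mod_cast hcard
      have hm0 : (m.totient : ℝ) ≠ 0 := by
        have := Nat.totient_pos.2 (Nat.pos_of_ne_zero hm.out)
        exact_mod_cast this.ne'
      have hcd : ((c + d : ℕ) : ℝ) ≠ 0 := by
        have : c + d ≠ 0 := by omega
        exact_mod_cast this
      have e4 : (T.card : ℝ) * (m.totient : ℝ)⁻¹ = c / ((c + d : ℕ) : ℝ) := by
        rw [← div_eq_mul_inv, div_eq_div_iff hm0 hcd, e3]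
      rw [e4, ← e2]; ring
    rw [hr]
    exact h
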